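/- Let 1 → U → G →(π) T → 1 be a short exact sequence of groups and Q a G-group. Suppose that for every γ ∈ Z^1(G,Q) and every δ ∈ Z^1(U,Q_γ) with the property that for each g ∈ G the map u ↦ δ(g u g^{-1}) * g (a 1-cocycle of U with values in Q_γ) is cohomologous to δ, the cocycle δ is a coboundary. Then the inflation map inf : H^1(T,Q^U) → H^1(G,Q) is a bijection of pointed sets. -/

import Mathlib

/-- A right action of a group `G` on a group `Q` by group automorphisms,
written `q ↦ q^g` in the paper; here `act q g`. -/
structure GAction (G : Type*) (Q : Type*) [Group G] [Group Q] where
  act : Q → G → Q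
  act_one : ∀ q, act q 1 = q
  act_mul : ∀ q g h, act (act q g) h = act q (g * h)
  act_map_mul : ∀ g q q', act (q * q') g = act q g * act q' g

namespace GAction

variable {G Q : Type*} [Group G] [Group Q]

/-- `γ : G → Q` is a 1-cocycle: `γ(gh) = γ(g)^h · γ(h)`. -/
def IsCocycle (A : GAction G Q) (γ : G → Q) : Prop :=
  ∀ g h : G, γ (g * h) = A.act (γ g) h * γ h

/-- Two 1-cochains are cohomologous: `δ(g) = (q^g)⁻¹ · γ(g) · q` for some `q`. -/
def Cohomologous (A : GAction G Q) (γ δ : G → Q) : Prop :=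
  ∃ q : Q, ∀ g : G, δ g = (A.act q g)⁻¹ * γ g * q

/-- `τ : G × G → Q` is a 2-cocycle: `τ(g,h)^k · τ(gh,k) = τ(h,k) · τ(g,hk)`. -/
def IsTwoCocycle (A : GAction G Q) (τ : G → G → Q) : Prop :=
  ∀ g h k : G, A.act (τ g h) k * τ (g * h) k = τ h k * τ g (h * k)

/-- Two 2-cochains are cohomologous:
`τ'(g,h) = τ(g,h) · φ(g)^h · φ(h) · φ(gh)⁻¹` for some `φ : G → Q`. -/
def TwoCohomologous (A : GAction G Q) (τ τ' : G → G → Q) : Prop :=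
  ∃ φ : G → Q, ∀ g h : G, τ' g h = τ g h * A.act (φ g) h * φ h * (φ (g * h))⁻¹

/-- The restriction of a `G`-action to a subgroup `B ≤ G`. -/
def res (A : GAction G Q) (B : Subgroup G) : GAction B Q where
  act q b := A.act q (b : G)
  act_one q := by simpa using A.act_one q
  act_mul q b c := by simpa using A.act_mul q (b : G) (c : G)
  act_map_mul b q q' := A.act_map_mul (b : G) q q'

end GAction

/-- `1 → R →(ι) Q →(π) S → 1` is a central extension of `G`-groups. -/
structure IsCentralExt {G R Q S : Type*} [Group G] [Group R] [Group Q] [Group S]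
    (AR : GAction G R) (AQ : GAction G Q) (AS : GAction G S)
    (ι : R →* Q) (π : Q →* S) : Prop where
  ι_inj : Function.Injective ι
  π_surj : Function.Surjective π
  exact : ∀ q : Q, π q = 1 ↔ ∃ r : R, ι r = q
  ι_equiv : ∀ (r : R) (g : G), ι (AR.act r g) = AQ.act (ι r) g
  π_equiv : ∀ (q : Q) (g : G), π (AQ.act q g) = AS.act (π q) g
  central : ∀ (r : R) (q : Q), ι r * q = q * ι r

namespace GAction

variable {G Q : Type*} [Group G] [Group Q]

theorem act_one_left (A : GAction G Q) (g : G) : A.act 1 g = 1 := by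
  simpa using A.act_map_mul g 1 1

theorem act_inv (A : GAction G Q) (q : Q) (g : G) : A.act q⁻¹ g = (A.act q g)⁻¹ := by
  rw [eq_inv_iff_mul_eq_one, ← A.act_map_mul, inv_mul_cancel, A.act_one_left]

namespace IsCocycle

variable {A : GAction G Q} {γ : G → Q}

theorem map_one (hγ : A.IsCocycle γ) : γ 1 = 1 := by
  simpa [A.act_one] using hγ 1 1

/-- A cocycle constant on the cosets of `U` is trivial on `U`. -/
theorem eq_one_of_mem (hγ : A.IsCocycle γ) {U : Subgroup G}
    (h : ∀ g : G, ∀ u ∈ U, γ (g * u) = γ g) {u : G} (hu : u ∈ U) : γ u = 1 := by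
  rw [← one_mul u, h 1 u hu, hγ.map_one]

/-- Conjugating a cocycle by `g` changes it by the coboundary of `γ g`. -/
theorem eq_conj (hγ : A.IsCocycle γ) (g u : G) :
    γ u = (A.act (γ g) u)⁻¹ * A.act (γ (g * u * g⁻¹)) g * γ g := by
  rw [mul_assoc, ← hγ, inv_mul_cancel_right, hγ, inv_mul_cancel_left]

theorem coboundary_twist (hγ : A.IsCocycle γ) (q : Q) :
    A.IsCocycle fun g => (A.act q g)⁻¹ * γ g * q := by
  intro g h
  simp only [hγ g h, A.act_map_mul, A.act_inv, A.act_mul]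
  group

end IsCocycle

end GAction

/-- Let `1 → U → G → T → 1` be a short exact sequence of groups
(`U ⊴ G`, `T = G/U`) and `Q` a `G`-group.  Suppose that for every `γ ∈ Z¹(G,Q)`
and every `δ ∈ Z¹(U, Q_γ)` (for the twisted action `q * g = γ(g)⁻¹ · q^g · γ(g)`)
such that for each `g ∈ G` the cocycle `u ↦ δ(g u g⁻¹) * g` is cohomologous to `δ`,
the cocycle `δ` is a coboundary.  Then the inflation map
`inf : H¹(T, Q^U) → H¹(G, Q)` is a bijection of pointed sets (classes of
`H¹(T,Q^U)` being encoded by their inflated `G`-cocycles: cocycles `G → Q`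
constant on `U`-cosets with `U`-fixed values). -/
theorem inflation_bijective
    {G Q : Type*} [Group G] [Group Q]
    (A : GAction G Q) (U : Subgroup G) (hU : U.Normal)
    (hyp : ∀ γ : G → Q, A.IsCocycle γ →
      ∀ δ : U → Q,
        -- `δ` is a cocycle of `U` with values in `Q_γ`
        (∀ u v : U, δ (u * v) = (γ (v : G))⁻¹ * A.act (δ u) (v : G) * γ (v : G) * δ v) →
        -- for each `g ∈ G`, `u ↦ δ(g u g⁻¹) * g` is cohomologous to `δ` in `Z¹(U,Q_γ)`
        (∀ g : G, ∃ q : Q, ∀ u : U,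
          δ u = ((γ (u : G))⁻¹ * A.act q (u : G) * γ (u : G))⁻¹ *
            ((γ g)⁻¹ * A.act (δ ⟨g * (u : G) * g⁻¹, hU.conj_mem (u : G) u.2 g⟩) g * γ g) * q) →
        -- then `δ` is a coboundary
        ∃ q : Q, ∀ u : U, δ u = ((γ (u : G))⁻¹ * A.act q (u : G) * γ (u : G))⁻¹ * q) :
    -- inflation is injective
    (∀ γ γ' : G → Q, A.IsCocycle γ → A.IsCocycle γ' →
      (∀ g : G, ∀ u ∈ U, γ (g * u) = γ g) → (∀ g : G, ∀ u ∈ U, A.act (γ g) u = γ g) →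
      (∀ g : G, ∀ u ∈ U, γ' (g * u) = γ' g) → (∀ g : G, ∀ u ∈ U, A.act (γ' g) u = γ' g) →
      A.Cohomologous γ γ' →
      ∃ q : Q, (∀ u ∈ U, A.act q u = q) ∧ ∀ g : G, γ' g = (A.act q g)⁻¹ * γ g * q)
    -- inflation is surjective
    ∧ (∀ γ : G → Q, A.IsCocycle γ →
      ∃ γ' : G → Q, A.IsCocycle γ' ∧ (∀ g : G, ∀ u ∈ U, γ' (g * u) = γ' g) ∧
        (∀ g : G, ∀ u ∈ U, A.act (γ' g) u = γ' g) ∧ A.Cohomologous γ γ') := by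
  constructor
  · rintro γ γ' hγ hγ' hγU - hγU' - ⟨q, hq⟩
    refine ⟨q, fun u hu => ?_, hq⟩
    have h := hq u
    rw [hγ.eq_one_of_mem hγU hu, hγ'.eq_one_of_mem hγU' hu, mul_one] at h
    exact inv_mul_eq_one.mp h.symm
  · intro γ hγ
    obtain ⟨q, hq⟩ := hyp (fun _ => 1) (fun g h => by simp [A.act_one_left])
      (fun u => γ u) (fun u v => by simpa using hγ u v)
      (fun g => ⟨γ g, fun u => by simpa using hγ.eq_conj g u⟩)
    have hco := hγ.coboundary_twist q⁻¹
    have hone : ∀ u ∈ U, (A.act q⁻¹ u)⁻¹ * γ u * q⁻¹ = 1 := fun u hu => by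
      have h := hq ⟨u, hu⟩
      simp only [inv_one, one_mul, mul_one] at h
      rw [h, A.act_inv]
      group
    have hinv : ∀ g : G, ∀ u ∈ U, (A.act q⁻¹ (g * u))⁻¹ * γ (g * u) * q⁻¹
        = (A.act q⁻¹ g)⁻¹ * γ g * q⁻¹ := fun g u hu => by
      have h := hco (g * u * g⁻¹) g
      simp only [inv_mul_cancel_right] at h
      rw [h, hone _ (hU.conj_mem u hu g), A.act_one_left, one_mul]
    refine ⟨_, hco, hinv, fun g u hu => ?_, q⁻¹, fun _ => rfl⟩
    have h := hco g u
    simp only [hone u hu, mul_one] at h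
    exact h.symm.trans (hinv g u hu)
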